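/- Let k, d, λ ≥ 1 be integers with d ≥ λ and k ≥ λ+1, let j be an integer in {λ+1,…,d−λ+2}, set β = β(λ,j) = ⌈(j+λ−1)/2⌉, and let a, r be integers satisfying: a ≥ 0, r ∈ {0,1,…,j−1}, if r ≥ β then β(a+1) ≤ k−1, and if r ≤ β−1 then (a+1)r + (β−r)a ≤ k−1. Then for any reals t₁ < … < t_n with n = (d−λ+1) + aj + r, the vertex set {γ(t₁),…,γ(t_n)} of the cyclic polytope in ℝ^d has a complete Kneser (d−λ)-transversal with respect to k; indeed one can choose the d−λ+1 points spanning the transversal so that of the remaining aj+r points, exactly a+1 lie in each of the first r gaps between/before consecutive chosen points and exactly a lie in each of the next j−r gaps. -/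

import Mathlib

open Finset

noncomputable section

/-- Points of `ℝ^d`. -/
abbrev Pt (d : ℕ) : Type := Fin d → ℝ

/-- `L` is a complete Kneser `(d-λ)`-transversal of the finite point set `X` with respect
to `k`. -/
def IsCompleteKneserTransversal (k d lam : ℕ) (X : Finset (Pt d))
    (L : AffineSubspace ℝ (Pt d)) : Prop :=
  Module.finrank ℝ L.direction = d - lam ∧
  (∃ T : Finset (Pt d), T ⊆ X ∧ T.card = d - lam + 1 ∧ (T : Set (Pt d)) ⊆ (L : Set (Pt d))) ∧
  ∀ Y : Finset (Pt d), Y ⊆ X → Y.card = k →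
    ((convexHull ℝ (Y : Set (Pt d))) ∩ (L : Set (Pt d))).Nonempty

/-- `X` has a complete Kneser `(d-λ)`-transversal with respect to `k`. -/
def HasCKT (k d lam : ℕ) (X : Finset (Pt d)) : Prop :=
  ∃ L : AffineSubspace ℝ (Pt d), IsCompleteKneserTransversal k d lam X L

/-- The moment curve `γ(t) = (t, t², …, t^d)` in `ℝ^d`. -/
def momentCurve (d : ℕ) (t : ℝ) : Pt d := fun i => t ^ ((i : ℕ) + 1)

/-- The vertex set `{γ(t₁), …, γ(t_n)}` of a cyclic polytope. -/
def cyclicVerts (d n : ℕ) (t : Fin n → ℝ) : Finset (Pt d) :=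
  Finset.image (fun i => momentCurve d (t i)) Finset.univ

/-- `β(λ,j) = ⌈(j+λ-1)/2⌉`; as naturals this is `(j+λ)/2`. -/
def betaVal (lam j : ℕ) : ℕ := (j + lam) / 2

/-- The 1-based position of the `j`-th chosen index (for `1 ≤ j ≤ m`), with the
conventions `pos 0 = 0` and `pos j = n+1` for `j > m`. -/
def posFun (n m : ℕ) (ι : Fin m → Fin n) (j : ℕ) : ℕ :=
  if h : 1 ≤ j ∧ j ≤ m then ((ι ⟨j - 1, by omega⟩ : Fin n) : ℕ) + 1
  else if j = 0 then 0 else n + 1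

/-- The set of indices lying strictly between the `(j-1)`-st and the `j`-th chosen
indices (the indices of the points of the gap `A_j`), for `j ∈ {1,…,m+1}`. -/
def gapIdx (n m : ℕ) (ι : Fin m → Fin n) (j : ℕ) : Finset (Fin n) :=
  Finset.univ.filter (fun i =>
    posFun n m ι (j - 1) < (i : ℕ) + 1 ∧ (i : ℕ) + 1 < posFun n m ι j)

/-- The moment curve sends distinct parameters to affinely independent points, as long as there
are at most `d + 1` of them. -/
lemma affineIndependent_momentCurve {d m : ℕ} (hm : m ≤ d + 1) {x : Fin m → ℝ}
    (hx : Function.Injective x) : AffineIndependent ℝ (fun i => momentCurve d (x i)) := by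
  rw [affineIndependent_iff_of_fintype]
  intro w hw hv
  rw [Finset.univ.weightedVSub_eq_linear_combination hw] at hv
  have key : w = 0 := by
    refine Matrix.eq_zero_of_forall_pow_sum_mul_pow_eq_zero hx fun i => ?_
    rcases Nat.eq_zero_or_pos (i : ℕ) with h0 | h0
    · simpa [h0] using hw
    · have h1 := congrFun hv ⟨(i : ℕ) - 1, by omega⟩
      simpa [momentCurve, Finset.sum_apply, Nat.sub_add_cancel h0] using h1
  intro i
  simp [key]

lemma momentCurve_injective {d : ℕ} (hd : 1 ≤ d) : Function.Injective (momentCurve d) := by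
  intro s t h
  simpa [momentCurve] using congrFun h ⟨0, hd⟩

open Polynomial in
/-- If the affine span of points of the moment curve misses the convex hull of a finite set, then
some polynomial of degree at most `d` vanishes at the parameters of the former points and is
positive at the parameters of the latter ones. -/
lemma exists_polynomial_of_disjoint {d m : ℕ} (hm : 0 < m) (x : Fin m → ℝ) (Y : Finset (Pt d))
    (h : ¬ ((convexHull ℝ (Y : Set (Pt d))) ∩
      (affineSpan ℝ (Set.range fun i => momentCurve d (x i)) : Set (Pt d))).Nonempty) :
    ∃ p : ℝ[X], p.natDegree ≤ d ∧ (∀ i, p.eval (x i) = 0) ∧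
      ∀ s, momentCurve d s ∈ Y → 0 < p.eval s := by
  set L := affineSpan ℝ (Set.range fun i => momentCurve d (x i)) with hL
  have hmem : ∀ i, momentCurve d (x i) ∈ L := fun i => subset_affineSpan ℝ _ ⟨i, rfl⟩
  obtain ⟨f, u, v, hu, huv, hv⟩ := geometric_hahn_banach_compact_closed
    (convex_convexHull ℝ _) (Y.finite_toSet.isCompact_convexHull (𝕜 := ℝ))
    (AffineSubspace.convex L) (AffineSubspace.closed_of_finiteDimensional L)
    (Set.disjoint_iff_inter_eq_empty.2 (Set.not_nonempty_iff_eq_empty.1 h))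
  have hconst : ∀ p ∈ L, ∀ q ∈ L, f p = f q := by
    intro p hp q hq
    by_contra hne
    have hne' : f q - f p ≠ 0 := sub_ne_zero.2 (Ne.symm hne)
    have h1 := hv _ (AffineMap.lineMap_mem ((v - f p) / (f q - f p)) hp hq)
    have h2 : f (AffineMap.lineMap p q ((v - f p) / (f q - f p))) = v := by
      simp only [AffineMap.lineMap_apply, vsub_eq_sub, vadd_eq_add, map_add, map_smul, map_sub,
        smul_eq_mul]
      field_simp
      ring
    exact absurd h1 (by rw [h2]; exact lt_irrefl v)
  set c := f (momentCurve d (x ⟨0, hm⟩)) with hc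
  have heval : ∀ s, (C c - ∑ i : Fin d, C (f (Pi.single i 1)) * X ^ ((i : ℕ) + 1)).eval s
      = c - f (momentCurve d s) := by
    intro s
    have h1 := LinearMap.pi_apply_eq_sum_univ f.toLinearMap (momentCurve d s)
    simp only [ContinuousLinearMap.coe_coe] at h1
    rw [h1]
    simp only [eval_sub, eval_C, eval_finsetSum, eval_mul, eval_pow, eval_X, smul_eq_mul,
      momentCurve]
    congr 1
    refine Finset.sum_congr rfl fun i _ => ?_
    rw [mul_comm]
    congr 2
    ext k
    simp [Pi.single_apply, eq_comm]
  refine ⟨C c - ∑ i : Fin d, C (f (Pi.single i 1)) * X ^ ((i : ℕ) + 1), ?_, fun i => ?_,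
    fun s hs => ?_⟩
  · refine (natDegree_sub_le _ _).trans (max_le (by simp) ?_)
    refine natDegree_sum_le_of_forall_le _ _ fun i _ => ?_
    exact (natDegree_C_mul_X_pow_le _ _).trans i.2
  · rw [heval, hc, hconst _ (hmem _) _ (hmem i), sub_self]
  · have h1 := hu _ (subset_convexHull ℝ _ hs)
    have h2 := hv _ (hmem ⟨0, hm⟩)
    rw [heval]
    linarith

open Polynomial in
/-- A set `S` of positive integers for which `q` changes sign between `y s` and `y (s + 1)` whenever
both indices lie in `S` is sparse, up to the number of roots of `q`. -/
lemma two_mul_card_le_of_sign_changes {q : ℝ[X]} (hq0 : q ≠ 0) {S : Finset ℕ} {y : ℕ → ℝ}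
    (hpos : ∀ s ∈ S, 1 ≤ s) (hy : ∀ s ∈ S, ∀ s' ∈ S, s < s' → y s < y s')
    (hq : ∀ s ∈ S, s + 1 ∈ S → q.eval (y s) * q.eval (y (s + 1)) < 0) :
    ∀ M ∈ S, 2 * (S.filter (· ≤ M)).card ≤
      M + 1 + (q.roots.toFinset.filter (· < y M)).card := by
  intro M
  induction M using Nat.strong_induction_on with
  | _ M ih =>
  intro hM
  have hcard : (S.filter (· ≤ M)).card = (S.filter (· < M)).card + 1 := by
    rw [← Finset.card_insert_of_notMem (a := M) (by simp)]
    congr 1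
    ext s
    simp only [Finset.mem_filter, Finset.mem_insert]
    constructor
    · rintro ⟨h1, h2⟩
      rcases h2.lt_or_eq with h | h <;> simp [*]
    · rintro (rfl | ⟨h1, h2⟩)
      · exact ⟨hM, le_rfl⟩
      · exact ⟨h1, h2.le⟩
  rcases (S.filter (· < M)).eq_empty_or_nonempty with he | hne
  · have := hpos M hM
    rw [hcard, he, Finset.card_empty]
    omega
  · set N := (S.filter (· < M)).max' hne with hN
    obtain ⟨hNS, hNM⟩ := Finset.mem_filter.1 (Finset.max'_mem _ hne)
    rw [← hN] at hNS hNM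
    have hfil : S.filter (· < M) = S.filter (· ≤ N) := by
      ext s
      simp only [Finset.mem_filter, and_congr_right_iff]
      exact fun hs => ⟨fun h => Finset.le_max' _ _ (Finset.mem_filter.2 ⟨hs, h⟩),
        fun h => h.trans_lt hNM⟩
    have h1 := ih N hNM hNS
    have hlt := hy N hNS M hM hNM
    have hsub : q.roots.toFinset.filter (· < y N) ⊆ q.roots.toFinset.filter (· < y M) :=
      Finset.monotone_filter_right _ fun z _ hz => hz.trans hlt
    rw [hcard, hfil]
    by_cases hadj : M = N + 1
    · have hs := hq N hNS (hadj ▸ hM)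
      rw [← hadj] at hs
      obtain ⟨z, hz, hz0⟩ : ∃ z ∈ Set.Ioo (y N) (y M), q.eval z = 0 := by
        rcases mul_neg_iff.1 hs with ⟨ha, hb⟩ | ⟨ha, hb⟩
        · exact intermediate_value_Ioo' hlt.le q.continuous.continuousOn ⟨hb, ha⟩
        · exact intermediate_value_Ioo hlt.le q.continuous.continuousOn ⟨ha, hb⟩
      have := Finset.card_lt_card (Finset.ssubset_iff_of_subset hsub |>.2
        ⟨z, by simp [hq0, hz0, hz.2], by simp [hz.1.le]⟩)
      omega
    · have := Finset.card_le_card hsub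
      omega

/-- The 1-based position of the `p`-th chosen point, when the first `r` gaps have size `a + 1`, the
following ones up to the `j`-th have size `a`, and the remaining ones are empty. -/
def chosenPos (a r j p : ℕ) : ℕ := p + min p j * a + min p r

lemma chosenPos_succ (a r j p : ℕ) : chosenPos a r j (p + 1) =
    chosenPos a r j p + 1 + (if p < j then a else 0) + (if p < r then 1 else 0) := by
  unfold chosenPos
  have h1 : min (p + 1) j * a = min p j * a + (if p < j then a else 0) := by
    split_ifs with h
    · rw [min_eq_left h, min_eq_left h.le]; ring
    · rw [min_eq_right (by omega), min_eq_right (by omega)]; rfl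
  rw [h1]
  split_ifs <;> omega

lemma chosenPos_strictMono (a r j : ℕ) : StrictMono (chosenPos a r j) :=
  strictMono_nat_of_lt_succ fun p => by rw [chosenPos_succ]; omega

/-- Every position that is not chosen lies in one of the first `j` gaps. -/
lemma exists_gap {a r j : ℕ} (hr : r ≤ j) {i : ℕ} (hi : 0 < i)
    (hne : ∀ p, 1 ≤ p → chosenPos a r j p ≠ i) :
    ∃ s, 1 ≤ s ∧ s ≤ j ∧ chosenPos a r j (s - 1) < i ∧ i < chosenPos a r j s := by
  have hex : ∃ s, i < chosenPos a r j s :=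
    ⟨i + 1, (Nat.lt_succ_self i).trans_le (chosenPos_strictMono a r j).le_apply⟩
  classical
  obtain ⟨s, hs, hmin⟩ : ∃ s, i < chosenPos a r j s ∧ ∀ p < s, chosenPos a r j p ≤ i :=
    ⟨Nat.find hex, Nat.find_spec hex, fun p hp => not_lt.1 (Nat.find_min hex hp)⟩
  obtain _ | p := s
  · simp [chosenPos] at hs
  have h1 : chosenPos a r j p < i := by
    refine lt_of_le_of_ne (hmin p p.lt_succ_self) ?_
    rcases Nat.eq_zero_or_pos p with rfl | h
    · simpa [chosenPos] using hi.ne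
    · exact hne p h
  refine ⟨p + 1, by omega, ?_, h1, hs⟩
  by_contra hcon
  rw [chosenPos_succ, if_neg (by omega), if_neg (by omega)] at hs
  omega

lemma card_filter_between (n A B : ℕ) (hB : B ≤ n + 1) :
    (Finset.univ.filter fun i : Fin n => A < (i : ℕ) + 1 ∧ (i : ℕ) + 1 < B).card = B - A - 1 := by
  have h : ((Finset.univ.filter fun i : Fin n => A < (i : ℕ) + 1 ∧ (i : ℕ) + 1 < B).map
      Fin.valEmbedding) = Finset.Ico A (B - 1) := by
    ext z
    simp only [Finset.mem_map, Finset.mem_filter, Finset.mem_univ, true_and,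
      Fin.valEmbedding_apply, Finset.mem_Ico]
    constructor
    · rintro ⟨i, hi, rfl⟩
      omega
    · intro hz
      exact ⟨⟨z, by omega⟩, by simp only; omega, rfl⟩
  rw [← Finset.card_map, h, Nat.card_Ico]
  omega

/-- A product of linear factors changes sign when exactly one of its roots is crossed. -/
lemma prod_sub_mul_prod_sub_neg {ι : Type*} [Fintype ι] (x : ι → ℝ) (u v : ℝ)
    (i₀ : ι) (h₀ : u < x i₀ ∧ x i₀ < v)
    (h : ∀ i, i ≠ i₀ → (x i < u ∧ x i < v) ∨ (u < x i ∧ v < x i)) :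
    (∏ i, (u - x i)) * ∏ i, (v - x i) < 0 := by
  classical
  rw [← Finset.prod_mul_distrib, ← Finset.mul_prod_erase _ _ (Finset.mem_univ i₀)]
  refine mul_neg_of_neg_of_pos (mul_neg_of_neg_of_pos (by linarith) (by linarith)) ?_
  refine Finset.prod_pos fun i hi => ?_
  rcases h i (Finset.ne_of_mem_erase hi) with ⟨h1, h2⟩ | ⟨h1, h2⟩
  · exact mul_pos (by linarith) (by linarith)
  · exact mul_pos_of_neg_of_neg (by linarith) (by linarith)

open Polynomial in
/-- A polynomial of degree at most `d` vanishing at all chosen points is positive on points of at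
most `betaVal lam j` gaps. -/
lemma card_le_betaVal {d lam a r j n : ℕ} (hlam : 1 ≤ lam) (hdl : lam ≤ d) {t : Fin n → ℝ}
    (ht : StrictMono t) {ι : Fin (d - lam + 1) → Fin n}
    (hι : ∀ p, (ι p : ℕ) + 1 = chosenPos a r j (p + 1)) (hj : j ≤ d - lam + 2)
    {p : ℝ[X]} (hp : p.natDegree ≤ d) (hp0 : ∀ i, p.eval (t (ι i)) = 0)
    {S : Finset ℕ} {y : ℕ → Fin n} (hS : ∀ s ∈ S, 1 ≤ s ∧ s ≤ j)
    (hgap : ∀ s ∈ S, chosenPos a r j (s - 1) < (y s : ℕ) + 1 ∧ (y s : ℕ) + 1 < chosenPos a r j s)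
    (hpos : ∀ s ∈ S, 0 < p.eval (t (y s))) : S.card ≤ betaVal lam j := by
  rcases S.eq_empty_or_nonempty with rfl | hne
  · simp
  have hmono := chosenPos_strictMono a r j
  have hιinj : Function.Injective ι := fun p q h => by
    have := hmono.injective ((hι p).symm.trans ((congrArg (fun z : Fin n => (z : ℕ) + 1) h).trans
      (hι q)))
    exact Fin.ext (by omega)
  set P : ℝ[X] := ∏ i, (X - C (t (ι i))) with hP
  have hPm : P.Monic := monic_prod_of_monic _ _ fun i _ => monic_X_sub_C _
  have hPdeg : P.natDegree = d - lam + 1 := by simp [hP]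
  obtain ⟨q, rfl⟩ : P ∣ p := by
    refine Finset.prod_dvd_of_coprime ?_ fun i _ => dvd_iff_isRoot.2 (hp0 i)
    intro i _ i' _ hii
    exact pairwise_coprime_X_sub_C (ht.injective.comp hιinj) hii
  have hq0 : q ≠ 0 := by
    rintro rfl
    obtain ⟨s, hs⟩ := hne
    simpa using hpos s hs
  have hqdeg : q.natDegree ≤ lam - 1 := by
    rw [hPm.natDegree_mul' hq0, hPdeg] at hp
    omega
  have hylt : ∀ s ∈ S, ∀ s' ∈ S, s < s' → t (y s) < t (y s') := by
    intro s hs s' hs' hlt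
    apply ht
    have := hmono.monotone (show s ≤ s' - 1 by omega)
    have := hgap s hs
    have := hgap s' hs'
    exact Fin.lt_def.2 (by omega)
  have hsign : ∀ s ∈ S, s + 1 ∈ S → q.eval (t (y s)) * q.eval (t (y (s + 1))) < 0 := by
    intro s hs hs'
    have h1 := hpos s hs
    have h2 := hpos _ hs'
    rw [eval_mul] at h1 h2
    have g1 := hgap s hs
    have g2 := hgap _ hs'
    have b1 := hS s hs
    have b2 := hS _ hs'
    rw [Nat.add_sub_cancel] at g2
    have hneg : P.eval (t (y s)) * P.eval (t (y (s + 1))) < 0 := by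
      simp only [hP, eval_prod, eval_sub, eval_X, eval_C]
      refine prod_sub_mul_prod_sub_neg (fun i => t (ι i)) _ _ ⟨s - 1, by omega⟩ ?_ ?_
      · have := hι ⟨s - 1, by omega⟩
        simp only [Nat.sub_add_cancel b1.1] at this
        exact ⟨ht (Fin.lt_def.2 (by omega)), ht (Fin.lt_def.2 (by omega))⟩
      · intro i hi
        have h3 := hι i
        have hi' : (i : ℕ) ≠ s - 1 := fun h => hi (Fin.ext h)
        rcases Nat.lt_or_gt_of_ne hi' with h | h
        · left
          have := hmono.monotone (show (i : ℕ) + 1 ≤ s - 1 by omega)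
          exact ⟨ht (Fin.lt_def.2 (by omega)), ht (Fin.lt_def.2 (by omega))⟩
        · right
          have := hmono.monotone (show s + 1 ≤ (i : ℕ) + 1 by omega)
          exact ⟨ht (Fin.lt_def.2 (by omega)), ht (Fin.lt_def.2 (by omega))⟩
    have h3 := mul_pos h1 h2
    by_contra hcon
    push Not at hcon
    nlinarith [mul_nonpos_of_nonpos_of_nonneg hneg.le hcon]
  have hM := S.max'_mem hne
  have hmain := two_mul_card_le_of_sign_changes (y := fun s => t (y s)) hq0
    (fun s hs => (hS s hs).1) hylt hsign _ hM
  rw [Finset.filter_true_of_mem fun s hs => S.le_max' s hs] at hmain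
  have h1 := (hS _ hM).2
  have h2 := (Finset.card_filter_le q.roots.toFinset (· < t (y (S.max' hne)))).trans
    ((Multiset.toFinset_card_le _).trans (card_roots' q))
  unfold betaVal
  omega

/-- `s` of the gaps hold at most `s * a + min s r` points, which the constraints bound. -/
lemma mul_add_min_le {a r β k s : ℕ} (h3 : β ≤ r → β * (a + 1) ≤ k - 1)
    (h4 : r < β → (a + 1) * r + (β - r) * a ≤ k - 1) (hs : s ≤ β) :
    s * a + min s r ≤ k - 1 := by
  have h1 : s * a + min s r ≤ β * a + min β r := by gcongr
  refine h1.trans ?_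
  rcases le_or_gt β r with h | h
  · rw [min_eq_left h]
    linarith [h3 h]
  · rw [min_eq_right h.le]
    obtain ⟨c, rfl⟩ := Nat.exists_eq_add_of_lt h
    have h2 := h4 h
    have : r + c + 1 - r = c + 1 := by omega
    rw [this] at h2
    linarith

lemma sum_gap_sizes_le {a r j : ℕ} {S : Finset ℕ} (hS : ∀ s ∈ S, 1 ≤ s ∧ s ≤ j) :
    ∑ s ∈ S, (chosenPos a r j s - chosenPos a r j (s - 1) - 1) ≤ S.card * a + min S.card r := by
  have h : ∀ s ∈ S, chosenPos a r j s - chosenPos a r j (s - 1) - 1 =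
      a + if s ≤ r then 1 else 0 := by
    intro s hs
    obtain ⟨h1, h2⟩ := hS s hs
    obtain ⟨p, rfl⟩ := Nat.exists_eq_add_of_le' h1
    rw [chosenPos_succ, Nat.add_sub_cancel, if_pos (by omega)]
    simp only [Nat.succ_le_iff]
    omega
  rw [Finset.sum_congr rfl h, Finset.sum_add_distrib, Finset.sum_const, smul_eq_mul,
    ← Finset.card_filter]
  gcongr
  refine le_min (Finset.card_filter_le _ _) ?_
  have hsub : S.filter (· ≤ r) ⊆ Finset.Icc 1 r := fun s hs => by
    rw [Finset.mem_filter] at hs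
    exact Finset.mem_Icc.2 ⟨(hS s hs.1).1, hs.2⟩
  simpa using Finset.card_le_card hsub

open Polynomial in
/-- A polynomial of degree at most `d` vanishing at all chosen points is positive at fewer than `k`
of the given points. -/
lemma card_le_of_eval_pos {k d lam a r j n : ℕ} (hlam : 1 ≤ lam) (hdl : lam ≤ d)
    (hj : j ≤ d - lam + 2) (hr : r ≤ j)
    (h3 : betaVal lam j ≤ r → betaVal lam j * (a + 1) ≤ k - 1)
    (h4 : r < betaVal lam j → (a + 1) * r + (betaVal lam j - r) * a ≤ k - 1)
    (hn : n = (d - lam + 1) + a * j + r) {t : Fin n → ℝ} (ht : StrictMono t)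
    {ι : Fin (d - lam + 1) → Fin n} (hι : ∀ p, (ι p : ℕ) + 1 = chosenPos a r j (p + 1))
    {p : ℝ[X]} (hp : p.natDegree ≤ d) (hp0 : ∀ i, p.eval (t (ι i)) = 0)
    {I : Finset (Fin n)} (hI : ∀ i ∈ I, 0 < p.eval (t i)) : I.card ≤ k - 1 := by
  classical
  have hmono := chosenPos_strictMono a r j
  have hlast : chosenPos a r j (d - lam + 1 + 1) = n + 1 := by
    unfold chosenPos
    rw [min_eq_right (by omega), min_eq_right (by omega), hn, mul_comm j a]
    omega
  have hex : ∀ i : Fin n, ∃ s, i ∈ I → 1 ≤ s ∧ s ≤ j ∧ chosenPos a r j (s - 1) < (i : ℕ) + 1 ∧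
      (i : ℕ) + 1 < chosenPos a r j s := by
    intro i
    by_cases hi : i ∈ I
    · obtain ⟨s, hs⟩ := exists_gap (a := a) hr (Nat.succ_pos (i : ℕ)) (by
        intro p h1 h2
        have hlt : p < d - lam + 1 + 1 := hmono.lt_iff_lt.1 (by omega)
        have h5 := hι ⟨p - 1, by omega⟩
        simp only [Nat.sub_add_cancel h1] at h5
        have h6 : i = ι ⟨p - 1, by omega⟩ := Fin.ext (by omega)
        have := hI i hi
        rw [h6, hp0] at this
        exact lt_irrefl _ this)
      exact ⟨s, fun _ => hs⟩
    · exact ⟨0, fun h => absurd h hi⟩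
  choose g hg using hex
  have hrep : ∀ s, ∃ i : Fin n, s ∈ I.image g → i ∈ I ∧ g i = s := by
    intro s
    by_cases hs : s ∈ I.image g
    · obtain ⟨i, hi⟩ := Finset.mem_image.1 hs
      exact ⟨i, fun _ => hi⟩
    · exact ⟨⟨0, by omega⟩, fun h => absurd h hs⟩
  choose y hy using hrep
  have hS : ∀ s ∈ I.image g, 1 ≤ s ∧ s ≤ j := by
    intro s hs
    obtain ⟨i, hi, rfl⟩ := Finset.mem_image.1 hs
    exact ⟨(hg i hi).1, (hg i hi).2.1⟩
  have hβ : (I.image g).card ≤ betaVal lam j := by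
    refine card_le_betaVal hlam hdl ht hι hj hp hp0 (y := y) hS (fun s hs => ?_) fun s hs => ?_
    · have := (hg _ (hy s hs).1).2.2
      rwa [(hy s hs).2] at this
    · exact hI _ (hy s hs).1
  refine le_trans ?_ ((sum_gap_sizes_le hS).trans (mul_add_min_le h3 h4 hβ))
  rw [Finset.card_eq_sum_card_image g I]
  refine Finset.sum_le_sum fun s hs => ?_
  have hle : chosenPos a r j s ≤ n + 1 := by
    rw [← hlast]
    exact hmono.monotone (by have := (hS s hs).2; omega)
  rw [← card_filter_between n _ _ hle]
  refine Finset.card_le_card fun i hi => ?_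
  obtain ⟨hi1, rfl⟩ := Finset.mem_filter.1 hi
  simpa using (hg i hi1).2.2

/-- if `j ∈ {λ+1,…,d-λ+2}`, `β = β(λ,j)`, and `a`, `r` satisfy the
constraints of the optimization problem, then the cyclic polytope in `ℝ^d` with
`n = (d-λ+1) + aj + r` vertices has a complete Kneser `(d-λ)`-transversal with respect
to `k`; indeed one can choose the `d-λ+1` chosen points so that exactly `a+1` of the
remaining points lie in each of the first `r` gaps and exactly `a` in each of the next
`j-r` gaps, and the affine span of the chosen points meets the convex hull of every
`k`-element subset of the vertex set. -/
theorem cyclic_construction (k d lam j a r : ℕ) (hk : 1 ≤ k) (hd : 1 ≤ d)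
    (hlam : 1 ≤ lam) (hdl : lam ≤ d) (hkl : lam + 1 ≤ k)
    (hj1 : lam + 1 ≤ j) (hj2 : j ≤ d - lam + 2) (hr : r < j)
    (h3 : betaVal lam j ≤ r → betaVal lam j * (a + 1) ≤ k - 1)
    (h4 : r < betaVal lam j → (a + 1) * r + (betaVal lam j - r) * a ≤ k - 1)
    (n : ℕ) (hn : n = (d - lam + 1) + a * j + r)
    (t : Fin n → ℝ) (ht : StrictMono t) :
    HasCKT k d lam (cyclicVerts d n t) ∧
    ∃ ι : Fin (d - lam + 1) → Fin n, StrictMono ι ∧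
      (∀ α ∈ Finset.Icc 1 r, (gapIdx n (d - lam + 1) ι α).card = a + 1) ∧
      (∀ α ∈ Finset.Icc (r + 1) j, (gapIdx n (d - lam + 1) ι α).card = a) ∧
      ∀ Y : Finset (Pt d), Y ⊆ cyclicVerts d n t → Y.card = k →
        ((convexHull ℝ (Y : Set (Pt d))) ∩
          ((affineSpan ℝ
              ((Finset.univ.image (fun i => momentCurve d (t (ι i)))) : Set (Pt d)) :
            AffineSubspace ℝ (Pt d)) : Set (Pt d))).Nonempty := by
  have hmono := chosenPos_strictMono a r j
  have hlast : chosenPos a r j (d - lam + 1 + 1) = n + 1 := by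
    unfold chosenPos
    rw [min_eq_right (by omega), min_eq_right (by omega), hn, mul_comm j a]
    omega
  have hbound : ∀ p : Fin (d - lam + 1), 1 ≤ chosenPos a r j (p + 1) ∧
      chosenPos a r j (p + 1) < n + 1 := by
    intro p
    have h1 := hmono.le_apply (x := (p : ℕ) + 1)
    have h2 := hmono (show (p : ℕ) + 1 < d - lam + 1 + 1 by omega)
    omega
  obtain ⟨ι, hι⟩ : ∃ ι : Fin (d - lam + 1) → Fin n,
      ∀ p, (ι p : ℕ) + 1 = chosenPos a r j (p + 1) :=
    ⟨fun p => ⟨chosenPos a r j (p + 1) - 1, by have := hbound p; omega⟩,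
      fun p => Nat.sub_add_cancel (hbound p).1⟩
  have hιmono : StrictMono ι := by
    intro p q hpq
    have h1 := hmono (show (p : ℕ) + 1 < q + 1 from Nat.succ_lt_succ hpq)
    have h2 := hι p
    have h3 := hι q
    exact Fin.lt_def.2 (by omega)
  have hposFun : ∀ p ≤ d - lam + 1 + 1, posFun n (d - lam + 1) ι p = chosenPos a r j p := by
    intro p hp
    unfold posFun
    split_ifs with h h0
    · rw [hι]
      simp only [Nat.sub_add_cancel h.1]
    · simp [h0, chosenPos]
    · rw [← hlast]
      congr 1
      omega
  have hgapcard : ∀ p < j, (gapIdx n (d - lam + 1) ι (p + 1)).card =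
      a + if p < r then 1 else 0 := by
    intro p hp
    have hle : chosenPos a r j (p + 1) ≤ n + 1 := by
      rw [← hlast]
      exact hmono.monotone (by omega)
    unfold gapIdx
    rw [hposFun _ (by omega), hposFun _ (by omega), card_filter_between _ _ _ hle, chosenPos_succ,
      if_pos hp, Nat.add_sub_cancel]
    omega
  have hinj : Function.Injective fun i => momentCurve d (t i) :=
    (momentCurve_injective hd).comp ht.injective
  have hcoe : ((Finset.univ.image (fun i => momentCurve d (t (ι i))) : Finset (Pt d)) :
      Set (Pt d)) = Set.range fun i => momentCurve d (t (ι i)) := by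
    simp
  have hmeet : ∀ Y : Finset (Pt d), Y ⊆ cyclicVerts d n t → Y.card = k →
      ((convexHull ℝ (Y : Set (Pt d))) ∩ (affineSpan ℝ
        (Set.range fun i => momentCurve d (t (ι i))) : Set (Pt d))).Nonempty := by
    intro Y hY hYk
    by_contra hcon
    obtain ⟨p, hp, hp0, hpos⟩ :=
      exists_polynomial_of_disjoint (Nat.succ_pos _) (fun i => t (ι i)) Y hcon
    have hle := card_le_of_eval_pos (I := Finset.univ.filter fun i => momentCurve d (t i) ∈ Y)
      hlam hdl hj2 hr.le h3 h4 hn ht hι hp hp0 fun i hi => hpos _ (Finset.mem_filter.1 hi).2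
    have hYle : Y ⊆ (Finset.univ.filter fun i => momentCurve d (t i) ∈ Y).image
        fun i => momentCurve d (t i) := by
      intro z hz
      obtain ⟨i, -, rfl⟩ := Finset.mem_image.1 (hY hz)
      exact Finset.mem_image.2 ⟨i, by simpa using hz, rfl⟩
    have := (Finset.card_le_card hYle).trans Finset.card_image_le
    omega
  refine ⟨⟨affineSpan ℝ (Set.range fun i => momentCurve d (t (ι i))), ?_, ?_, hmeet⟩,
    ι, hιmono, ?_, ?_, ?_⟩
  · rw [direction_affineSpan]
    exact (affineIndependent_momentCurve (by omega)
      (ht.injective.comp hιmono.injective)).finrank_vectorSpan (by simp)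
  · refine ⟨Finset.univ.image fun i => momentCurve d (t (ι i)), ?_, ?_, ?_⟩
    · intro z hz
      obtain ⟨i, -, rfl⟩ := Finset.mem_image.1 hz
      exact Finset.mem_image.2 ⟨ι i, Finset.mem_univ _, rfl⟩
    · rw [Finset.card_image_of_injective _ (show Function.Injective fun i => momentCurve d (t (ι i)) from
        hinj.comp hιmono.injective), Finset.card_univ,
        Fintype.card_fin]
    · rw [hcoe]
      exact subset_affineSpan ℝ _
  · intro α hα
    obtain ⟨h1, h2⟩ := Finset.mem_Icc.1 hα
    obtain ⟨p, rfl⟩ := Nat.exists_eq_add_of_le' h1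
    rw [hgapcard p (by omega), if_pos (by omega)]
  · intro α hα
    obtain ⟨h1, h2⟩ := Finset.mem_Icc.1 hα
    obtain ⟨p, rfl⟩ := Nat.exists_eq_add_of_le' (show 1 ≤ α by omega)
    rw [hgapcard p (by omega), if_neg (by omega), add_zero]
  · rw [hcoe]
    exact hmeet
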